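/- The function q is three times differentiable on [0,∞) (one-sided at 0), and its third derivative satisfies |q'''(r)| ≤ 5α + 2α(α𝓡² + 1) + 2(α𝓡² + 1)/𝓡² for every r ≥ 0. -/

import Mathlib

open MeasureTheory Real

/-- The concave reweighting function τ from the Eberle-type construction. -/
noncomputable def tau (R r : ℝ) : ℝ :=
  if r ≤ R then r ^ 2 / 2
  else if r ≤ 2 * R then
    R ^ 2 / 2 + R * (r - R) + (r - R) ^ 2 / 2 - (r - R) ^ 3 / (3 * R)
  else if r ≤ 4 * R then
    5 * R ^ 2 / 3 + R * (r - 2 * R) - (r - 2 * R) ^ 2 / 2 + (r - 2 * R) ^ 3 / (12 * R)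
  else 7 * R ^ 2 / 3

/-- The cutoff function μ. -/
noncomputable def muf (R r : ℝ) : ℝ :=
  if r ≤ R then 1
  else if r ≤ 4 * R then 1 / 2 + 1 / 2 * Real.cos (Real.pi * (r - R) / (3 * R))
  else 0

/-- ψ(r) = exp(−α τ(r)). -/
noncomputable def psi (α R r : ℝ) : ℝ := Real.exp (-(α * tau R r))

/-- Ψ(r) = ∫₀ʳ ψ(s) ds. -/
noncomputable def PsiInt (α R r : ℝ) : ℝ := ∫ s in (0:ℝ)..r, psi α R s

/-- ν(r) = 1 − (1/2) (∫₀ʳ μΨ/ψ) / (∫₀^{4R} μΨ/ψ). -/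
noncomputable def nuf (α R r : ℝ) : ℝ :=
  1 - (1 / 2) * (∫ s in (0:ℝ)..r, muf R s * PsiInt α R s / psi α R s) /
      (∫ s in (0:ℝ)..(4 * R), muf R s * PsiInt α R s / psi α R s)

/-- q(r) = ∫₀ʳ ψ(s) ν(s) ds. -/
noncomputable def qf (α R r : ℝ) : ℝ := ∫ s in (0:ℝ)..r, psi α R s * nuf α R s


theorem glue_deriv (a : ℝ) (g h g' h' : ℝ → ℝ) (hg : ∀ x, HasDerivAt g (g' x) x)
    (hh : ∀ x, HasDerivAt h (h' x) x) (e : g a = h a) (e' : g' a = h' a) (x : ℝ) :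
    HasDerivAt (fun x => if x ≤ a then g x else h x) (if x ≤ a then g' x else h' x) x := by
  rcases lt_trichotomy x a with hx | hx | hx
  · rw [if_pos hx.le]
    refine (hg x).congr_of_eventuallyEq ?_
    filter_upwards [Iio_mem_nhds hx] with y hy
    exact if_pos (le_of_lt hy)
  · subst hx
    rw [if_pos le_rfl]
    have h1 : HasDerivWithinAt (fun y => if y ≤ x then g y else h y) (g' x) (Set.Iic x) x := by
      refine (hg x).hasDerivWithinAt.congr (fun y hy => if_pos hy) (if_pos le_rfl)
    have h2 : HasDerivWithinAt (fun y => if y ≤ x then g y else h y) (g' x) (Set.Ici x) x := by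
      rw [e']
      refine (hh x).hasDerivWithinAt.congr (fun y hy => ?_) ?_
      · rcases eq_or_lt_of_le (show x ≤ y from hy) with h | h
        · subst h; simp [e]
        · exact if_neg (not_le.2 h)
      · simp [e]
    have := h1.union h2
    rwa [Set.Iic_union_Ici, hasDerivWithinAt_univ] at this
  · rw [if_neg (not_le.2 hx)]
    refine (hh x).congr_of_eventuallyEq ?_
    filter_upwards [Ioi_mem_nhds hx] with y hy
    exact if_neg (not_le.2 hy)

noncomputable def tau1 (R r : ℝ) : ℝ :=
  if r ≤ R then r
  else if r ≤ 2 * R then R + (r - R) - (r - R) ^ 2 / R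
  else if r ≤ 4 * R then R - (r - 2 * R) + (r - 2 * R) ^ 2 / (4 * R)
  else 0

noncomputable def tau2 (R r : ℝ) : ℝ :=
  if r ≤ R then 1
  else if r ≤ 2 * R then 1 - 2 * (r - R) / R
  else if r ≤ 4 * R then -1 + (r - 2 * R) / (2 * R)
  else 0

noncomputable def mu1 (R r : ℝ) : ℝ :=
  if r ≤ R then 0
  else if r ≤ 4 * R then -(Real.pi / (6 * R) * Real.sin (Real.pi * (r - R) / (3 * R)))
  else 0

theorem tau_deriv (R : ℝ) (hR : 0 < R) (r : ℝ) : HasDerivAt (tau R) (tau1 R r) r := by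
  have hR0 := hR.ne'
  unfold tau tau1
  refine glue_deriv R (fun r => r ^ 2 / 2) _ (fun r => r) _ ?_
    (glue_deriv (2 * R) (fun r => R ^ 2 / 2 + R * (r - R) + (r - R) ^ 2 / 2 - (r - R) ^ 3 / (3 * R))
      _ (fun r => R + (r - R) - (r - R) ^ 2 / R) _ ?_
      (glue_deriv (4 * R) (fun r => 5 * R ^ 2 / 3 + R * (r - 2 * R) - (r - 2 * R) ^ 2 / 2
        + (r - 2 * R) ^ 3 / (12 * R)) (fun _ => 7 * R ^ 2 / 3)
        (fun r => R - (r - 2 * R) + (r - 2 * R) ^ 2 / (4 * R)) (fun _ => 0) ?_ ?_ ?_ ?_) ?_ ?_) ?_ ?_ r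
  · intro x
    refine HasDerivAt.congr_deriv (((hasDerivAt_id x).pow 2).div_const 2) ?_
    simp
  · intro x
    have h := (hasDerivAt_id x).sub_const R
    refine HasDerivAt.congr_deriv ((((h.const_mul R).const_add (R ^ 2 / 2)).add ((h.pow 2).div_const 2)).sub
      ((h.pow 3).div_const (3 * R))) ?_
    simp; field_simp
  · intro x
    have h := (hasDerivAt_id x).sub_const (2 * R)
    refine HasDerivAt.congr_deriv ((((h.const_mul R).const_add (5 * R ^ 2 / 3)).sub ((h.pow 2).div_const 2)).add
      ((h.pow 3).div_const (12 * R))) ?_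
    simp; field_simp; ring
  · intro x; exact hasDerivAt_const _ _
  · field_simp; ring
  · field_simp; ring
  · rw [if_pos (by linarith)]; field_simp; ring
  · rw [if_pos (by linarith)]; field_simp; ring
  · rw [if_pos (by linarith)]; field_simp; ring
  · rw [if_pos (by linarith)]; field_simp; ring

theorem tau1_deriv (R : ℝ) (hR : 0 < R) (r : ℝ) : HasDerivAt (tau1 R) (tau2 R r) r := by
  have hR0 := hR.ne'
  unfold tau1 tau2
  refine glue_deriv R (fun r => r) _ (fun r => 1) _ (fun x => hasDerivAt_id x)
    (glue_deriv (2 * R) (fun r => R + (r - R) - (r - R) ^ 2 / R)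
      _ (fun r => 1 - 2 * (r - R) / R) _ ?_
      (glue_deriv (4 * R) (fun r => R - (r - 2 * R) + (r - 2 * R) ^ 2 / (4 * R)) (fun _ => 0)
        (fun r => -1 + (r - 2 * R) / (2 * R)) (fun _ => 0) ?_ ?_ ?_ ?_) ?_ ?_) ?_ ?_ r
  · intro x
    have h := (hasDerivAt_id x).sub_const R
    refine HasDerivAt.congr_deriv ((h.const_add R).sub ((h.pow 2).div_const R)) ?_
    simp
  · intro x
    have h := (hasDerivAt_id x).sub_const (2 * R)
    refine HasDerivAt.congr_deriv ((h.const_sub R).add ((h.pow 2).div_const (4 * R))) ?_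
    simp; field_simp; ring
  · intro x; exact hasDerivAt_const _ _
  · field_simp; ring
  · field_simp; ring
  · rw [if_pos (by linarith)]; field_simp; ring
  · rw [if_pos (by linarith)]; field_simp; ring
  · rw [if_pos (by linarith)]; field_simp; ring
  · rw [if_pos (by linarith)]; field_simp; ring

theorem mu_deriv (R : ℝ) (hR : 0 < R) (r : ℝ) : HasDerivAt (muf R) (mu1 R r) r := by
  have hR0 := hR.ne'
  have e4 : Real.pi * (4 * R - R) / (3 * R) = Real.pi := by field_simp; ring
  have e1 : Real.pi * (R - R) / (3 * R) = 0 := by simp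
  unfold muf mu1
  refine glue_deriv R (fun r => 1) _ (fun r => 0) _ (fun x => hasDerivAt_const _ _)
    (glue_deriv (4 * R) (fun r => 1 / 2 + 1 / 2 * Real.cos (Real.pi * (r - R) / (3 * R)))
      (fun _ => 0)
      (fun r => -(Real.pi / (6 * R) * Real.sin (Real.pi * (r - R) / (3 * R))))
      (fun _ => 0) ?_ (fun x => hasDerivAt_const _ _) ?_ ?_) ?_ ?_ r
  · intro x
    have h := ((((hasDerivAt_id x).sub_const R).const_mul Real.pi).div_const (3 * R)).cos
    refine HasDerivAt.congr_deriv ((h.const_mul (1 / 2)).const_add (1 / 2)) ?_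
    simp; field_simp; ring
  · simp only [e4, Real.cos_pi]; norm_num
  · simp only [e4, Real.sin_pi]; norm_num
  · rw [if_pos (by linarith)]; simp only [e1, Real.cos_zero]; norm_num
  · rw [if_pos (by linarith)]; simp only [e1, Real.sin_zero]; norm_num

theorem tau1_nonneg (R : ℝ) (hR : 0 < R) (r : ℝ) (hr : 0 ≤ r) : 0 ≤ tau1 R r := by
  unfold tau1
  split_ifs with h1 h2 h3
  · exact hr
  · push Not at h1
    have : (r - R) ^ 2 / R ≤ r - R := by
      rw [div_le_iff₀ hR]; nlinarith
    linarith
  · have : R - (r - 2 * R) + (r - 2 * R) ^ 2 / (4 * R) = (r - 4 * R) ^ 2 / (4 * R) := by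
      field_simp; ring
    rw [this]; positivity
  · exact le_rfl

theorem tau1_le (R : ℝ) (hR : 0 < R) (r : ℝ) : tau1 R r ≤ 5 / 4 * R := by
  unfold tau1
  split_ifs with h1 h2 h3
  · linarith
  · have : R + (r - R) - (r - R) ^ 2 / R = 5 / 4 * R - (r - R - R / 2) ^ 2 / R := by
      field_simp; ring
    rw [this]
    have : 0 ≤ (r - R - R / 2) ^ 2 / R := by positivity
    linarith
  · push Not at h2
    have : (r - 2 * R) ^ 2 / (4 * R) ≤ r - 2 * R := by
      rw [div_le_iff₀ (by positivity)]; nlinarith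
    linarith
  · positivity

theorem tau2_abs (R : ℝ) (hR : 0 < R) (r : ℝ) : |tau2 R r| ≤ 1 := by
  unfold tau2
  rw [abs_le]
  split_ifs with h1 h2 h3
  · norm_num
  · push Not at h1
    have h4 : 2 * (r - R) / R ≤ 2 := by rw [div_le_iff₀ hR]; linarith
    have h5 : 0 ≤ 2 * (r - R) / R := div_nonneg (by linarith) hR.le
    constructor <;> linarith
  · push Not at h2
    have h4 : (r - 2 * R) / (2 * R) ≤ 1 := by rw [div_le_iff₀ (by positivity)]; linarith
    have h5 : 0 ≤ (r - 2 * R) / (2 * R) := div_nonneg (by linarith) (by positivity)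
    constructor <;> linarith
  · norm_num

theorem mu1_abs (R : ℝ) (hR : 0 < R) (r : ℝ) : |mu1 R r| ≤ 2 / (3 * R) := by
  have h0 : (0:ℝ) ≤ 2 / (3 * R) := by positivity
  unfold mu1
  split_ifs with h1 h2
  · simpa using h0
  · rw [abs_neg, abs_mul, abs_of_nonneg (by positivity : 0 ≤ Real.pi / (6 * R))]
    have h3 : Real.pi / (6 * R) ≤ 2 / (3 * R) := by
      rw [div_le_div_iff₀ (by positivity) (by positivity)]
      nlinarith [Real.pi_le_four]
    calc _ ≤ Real.pi / (6 * R) * 1 := by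
          gcongr; exact Real.abs_sin_le_one _
      _ ≤ _ := by linarith
  · simpa using h0

theorem mu_nonneg (R r : ℝ) : 0 ≤ muf R r := by
  unfold muf
  split_ifs <;> linarith [Real.neg_one_le_cos (Real.pi * (r - R) / (3 * R))]

theorem mu_le_one (R r : ℝ) : muf R r ≤ 1 := by
  unfold muf
  split_ifs <;> linarith [Real.cos_le_one (Real.pi * (r - R) / (3 * R))]

theorem mu_ge_half (R : ℝ) (hR : 0 < R) (r : ℝ) (hr : r ≤ 2 * R) : 1 / 2 ≤ muf R r := by
  unfold muf
  split_ifs with h1 h2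
  · norm_num
  · push Not at h1
    have : 0 ≤ Real.cos (Real.pi * (r - R) / (3 * R)) := by
      have hp := Real.pi_pos
      apply Real.cos_nonneg_of_neg_pi_div_two_le_of_le
      · have : 0 ≤ Real.pi * (r - R) / (3 * R) :=
          div_nonneg (mul_nonneg hp.le (by linarith)) (by positivity)
        linarith
      · rw [div_le_div_iff₀ (by positivity) (by positivity)]
        nlinarith
    linarith
  · linarith

theorem tau_mono (R : ℝ) (hR : 0 < R) : MonotoneOn (tau R) (Set.Ici 0) := by
  apply monotoneOn_of_deriv_nonneg (convex_Ici 0)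
  · exact fun x _ => (tau_deriv R hR x).continuousAt.continuousWithinAt
  · exact fun x _ => (tau_deriv R hR x).differentiableAt.differentiableWithinAt
  · intro x hx
    rw [(tau_deriv R hR x).deriv]
    rw [interior_Ici] at hx
    exact tau1_nonneg R hR x (le_of_lt hx)

theorem psi_pos (α R r : ℝ) : 0 < psi α R r := Real.exp_pos _

theorem psi_anti (α R : ℝ) (hα : 0 < α) (hR : 0 < R) (s r : ℝ) (hs : 0 ≤ s) (hsr : s ≤ r) :
    psi α R r ≤ psi α R s := by
  unfold psi
  have := tau_mono R hR hs (le_trans hs hsr : (0:ℝ) ≤ r) hsr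
  apply Real.exp_le_exp.2
  nlinarith

theorem psi_le_one (α R : ℝ) (hα : 0 < α) (hR : 0 < R) (r : ℝ) (hr : 0 ≤ r) :
    psi α R r ≤ 1 := by
  refine (psi_anti α R hα hR 0 r le_rfl hr).trans ?_
  simp [psi, tau, hR.le]

theorem psi_deriv (α R : ℝ) (hR : 0 < R) (r : ℝ) :
    HasDerivAt (psi α R) (-(α * tau1 R r * psi α R r)) r := by
  have := (((tau_deriv R hR r).const_mul α).neg).exp
  refine HasDerivAt.congr_deriv this ?_
  simp only [psi, Pi.neg_apply]
  ring

theorem psi_cont (α R : ℝ) (hR : 0 < R) : Continuous (psi α R) :=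
  continuous_iff_continuousAt.2 fun x => (psi_deriv α R hR x).continuousAt

theorem mu_cont (R : ℝ) (hR : 0 < R) : Continuous (muf R) :=
  continuous_iff_continuousAt.2 fun x => (mu_deriv R hR x).continuousAt

theorem prim_deriv (f : ℝ → ℝ) (hf : Continuous f) (r : ℝ) :
    HasDerivAt (fun r => ∫ s in (0:ℝ)..r, f s) (f r) r :=
  (hf.integral_hasStrictDerivAt 0 r).hasDerivAt

theorem PsiInt_deriv (α R : ℝ) (hR : 0 < R) (r : ℝ) :
    HasDerivAt (PsiInt α R) (psi α R r) r :=
  prim_deriv _ (psi_cont α R hR) r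

theorem PsiInt_cont (α R : ℝ) (hR : 0 < R) : Continuous (PsiInt α R) :=
  continuous_iff_continuousAt.2 fun x => (PsiInt_deriv α R hR x).continuousAt

theorem PsiInt_ge (α R : ℝ) (hα : 0 < α) (hR : 0 < R) (r : ℝ) (hr : 0 ≤ r) :
    r * psi α R r ≤ PsiInt α R r := by
  have h : ∫ s in (0:ℝ)..r, psi α R r ≤ ∫ s in (0:ℝ)..r, psi α R s := by
    apply intervalIntegral.integral_mono_on hr
    · exact intervalIntegrable_const
    · exact (psi_cont α R hR).intervalIntegrable _ _
    · intro x hx; exact psi_anti α R hα hR x r hx.1 hx.2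
  simpa [PsiInt] using h

theorem PsiInt_le (α R : ℝ) (hα : 0 < α) (hR : 0 < R) (r : ℝ) (hr : 0 ≤ r) :
    PsiInt α R r ≤ r := by
  have h : ∫ s in (0:ℝ)..r, psi α R s ≤ ∫ s in (0:ℝ)..r, (1:ℝ) := by
    apply intervalIntegral.integral_mono_on hr
    · exact (psi_cont α R hR).intervalIntegrable _ _
    · exact intervalIntegrable_const
    · intro x hx; exact psi_le_one α R hα hR x hx.1
  simpa [PsiInt] using h

theorem PsiInt_nonneg (α R : ℝ) (hα : 0 < α) (hR : 0 < R) (r : ℝ) (hr : 0 ≤ r) :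
    0 ≤ PsiInt α R r :=
  (mul_nonneg hr (psi_pos α R r).le).trans (PsiInt_ge α R hα hR r hr)

noncomputable def gg (α R s : ℝ) : ℝ := muf R s * PsiInt α R s / psi α R s

theorem gg_cont (α R : ℝ) (hR : 0 < R) : Continuous (gg α R) :=
  ((mu_cont R hR).mul (PsiInt_cont α R hR)).div (psi_cont α R hR) fun x => (psi_pos α R x).ne'

theorem gg_nonneg (α R : ℝ) (hα : 0 < α) (hR : 0 < R) (r : ℝ) (hr : 0 ≤ r) : 0 ≤ gg α R r :=
  div_nonneg (mul_nonneg (mu_nonneg R r) (PsiInt_nonneg α R hα hR r hr)) (psi_pos α R r).le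

noncomputable def CC (α R : ℝ) : ℝ := ∫ s in (0:ℝ)..(4 * R), gg α R s

theorem gg_split (α R : ℝ) (hα : 0 < α) (hR : 0 < R) (a b : ℝ) (ha : 0 ≤ a) (hab : a ≤ b) :
    ∫ s in (0:ℝ)..a, gg α R s ≤ ∫ s in (0:ℝ)..b, gg α R s := by
  have hi : ∀ a b, IntervalIntegrable (gg α R) volume a b :=
    fun a b => (gg_cont α R hR).intervalIntegrable a b
  rw [← intervalIntegral.integral_add_adjacent_intervals (hi 0 a) (hi a b)]
  have : 0 ≤ ∫ s in a..b, gg α R s :=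
    intervalIntegral.integral_nonneg hab fun x hx => gg_nonneg α R hα hR x (ha.trans hx.1)
  linarith

theorem CC_ge (α R : ℝ) (hα : 0 < α) (hR : 0 < R) : R ^ 2 ≤ CC α R := by
  have h1 := gg_split α R hα hR (2 * R) (4 * R) (by positivity) (by linarith)
  have h2 : ∫ s in (0:ℝ)..(2 * R), (1 / 2 * s) ≤ ∫ s in (0:ℝ)..(2 * R), gg α R s := by
    apply intervalIntegral.integral_mono_on (by positivity)
    · exact (by fun_prop : Continuous fun s : ℝ => 1 / 2 * s).intervalIntegrable _ _
    · exact (gg_cont α R hR).intervalIntegrable _ _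
    · intro x hx
      unfold gg
      rw [le_div_iff₀ (psi_pos α R x), mul_assoc]
      exact mul_le_mul (mu_ge_half R hR x hx.2) (PsiInt_ge α R hα hR x hx.1)
        (mul_nonneg hx.1 (psi_pos α R x).le) (mu_nonneg R x)
  rw [intervalIntegral.integral_const_mul, integral_id] at h2
  unfold CC
  nlinarith

theorem nuf_eq (α R r : ℝ) : nuf α R r = 1 - 1 / 2 * (∫ s in (0:ℝ)..r, gg α R s) / CC α R := rfl

theorem nuf_deriv (α R : ℝ) (hR : 0 < R) (r : ℝ) :
    HasDerivAt (nuf α R) (-(1 / 2 * gg α R r / CC α R)) r :=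
  (((prim_deriv _ (gg_cont α R hR) r).const_mul (1 / 2)).div_const (CC α R)).const_sub 1

theorem nuf_cont (α R : ℝ) (hR : 0 < R) : Continuous (nuf α R) :=
  continuous_iff_continuousAt.2 fun x => (nuf_deriv α R hR x).continuousAt

theorem nuf_nonneg (α R : ℝ) (hα : 0 < α) (hR : 0 < R) (r : ℝ) (hr : 0 ≤ r) (h4 : r ≤ 4 * R) :
    0 ≤ nuf α R r := by
  have hC : 0 < CC α R := lt_of_lt_of_le (by positivity) (CC_ge α R hα hR)
  have := gg_split α R hα hR r (4 * R) hr h4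
  rw [nuf_eq, sub_nonneg, div_le_one hC]
  change _ ≤ CC α R at this
  linarith

theorem nuf_le_one (α R : ℝ) (hα : 0 < α) (hR : 0 < R) (r : ℝ) (hr : 0 ≤ r) :
    nuf α R r ≤ 1 := by
  have hC : 0 < CC α R := lt_of_lt_of_le (by positivity) (CC_ge α R hα hR)
  have h0 : 0 ≤ ∫ s in (0:ℝ)..r, gg α R s :=
    intervalIntegral.integral_nonneg hr fun x hx => gg_nonneg α R hα hR x hx.1
  rw [nuf_eq]
  have : 0 ≤ 1 / 2 * (∫ s in (0:ℝ)..r, gg α R s) / CC α R := by positivity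
  linarith

theorem q_deriv1 (α R : ℝ) (hR : 0 < R) (r : ℝ) :
    HasDerivAt (qf α R) (psi α R r * nuf α R r) r :=
  prim_deriv _ ((psi_cont α R hR).mul (nuf_cont α R hR)) r

theorem q_deriv2 (α R : ℝ) (hR : 0 < R) (r : ℝ) :
    HasDerivAt (fun r => psi α R r * nuf α R r)
      (-(α * (tau1 R r * (psi α R r * nuf α R r))) - muf R r * PsiInt α R r / (2 * CC α R)) r := by
  refine HasDerivAt.congr_deriv ((psi_deriv α R hR r).mul (nuf_deriv α R hR r)) ?_
  have := (psi_pos α R r).ne'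
  have e : psi α R r * gg α R r = muf R r * PsiInt α R r := by
    unfold gg; field_simp
  rw [← e]
  simp only [div_eq_mul_inv, mul_inv]
  ring

noncomputable def q3 (α R r : ℝ) : ℝ :=
  psi α R r * nuf α R r * (α ^ 2 * tau1 R r ^ 2 - α * tau2 R r)
    + (α * tau1 R r * (muf R r * PsiInt α R r) - mu1 R r * PsiInt α R r - muf R r * psi α R r)
      / (2 * CC α R)

theorem q_deriv3 (α R : ℝ) (hR : 0 < R) (r : ℝ) :
    HasDerivAt (fun r => -(α * (tau1 R r * (psi α R r * nuf α R r)))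
      - muf R r * PsiInt α R r / (2 * CC α R)) (q3 α R r) r := by
  refine HasDerivAt.congr_deriv (((((tau1_deriv R hR r).mul (q_deriv2 α R hR r)).const_mul α).neg).sub
    (((mu_deriv R hR r).mul (PsiInt_deriv α R hR r)).div_const (2 * CC α R))) ?_
  unfold q3
  simp only [div_eq_mul_inv]
  ring

theorem q3_bound (α R : ℝ) (hα : 0 < α) (hR : 0 < R) (r : ℝ) (hr : 0 ≤ r) :
    |q3 α R r| ≤ 5 * α + 2 * α * (α * R ^ 2 + 1) + 2 * (α * R ^ 2 + 1) / R ^ 2 := by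
  have hpos : 0 ≤ 5 * α + 2 * α * (α * R ^ 2 + 1) + 2 * (α * R ^ 2 + 1) / R ^ 2 := by positivity
  rcases lt_or_ge (4 * R) r with h4 | h4
  · have a1 : ¬ r ≤ R := by linarith
    have a2 : ¬ r ≤ 2 * R := by linarith
    have a3 : ¬ r ≤ 4 * R := by linarith
    have : q3 α R r = 0 := by simp [q3, tau1, tau2, muf, mu1, a1, a2, a3]
    rw [this, abs_zero]; exact hpos
  have hC := CC_ge α R hα hR
  have hC0 : 0 < CC α R := lt_of_lt_of_le (by positivity) hC
  have p0 := (psi_pos α R r).le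
  have p1 := psi_le_one α R hα hR r hr
  have n0 := nuf_nonneg α R hα hR r hr h4
  have n1 := nuf_le_one α R hα hR r hr
  have t0 := tau1_nonneg R hR r hr
  have t1 := tau1_le R hR r
  have t2 := tau2_abs R hR r
  have P0 := PsiInt_nonneg α R hα hR r hr
  have P1 := (PsiInt_le α R hα hR r hr).trans h4
  have m0 := mu_nonneg R r
  have m1 := mu_le_one R r
  have m2 := mu1_abs R hR r
  have A : |psi α R r * nuf α R r * (α ^ 2 * tau1 R r ^ 2 - α * tau2 R r)|
      ≤ α ^ 2 * (5 / 4 * R) ^ 2 + α := by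
    rw [abs_mul, abs_of_nonneg (mul_nonneg p0 n0)]
    have : |α ^ 2 * tau1 R r ^ 2 - α * tau2 R r| ≤ α ^ 2 * (5 / 4 * R) ^ 2 + α := by
      refine (abs_sub _ _).trans ?_
      rw [abs_of_nonneg (by positivity : 0 ≤ α ^ 2 * tau1 R r ^ 2), abs_mul, abs_of_pos hα]
      have : α * |tau2 R r| ≤ α * 1 := by gcongr
      have : α ^ 2 * tau1 R r ^ 2 ≤ α ^ 2 * (5 / 4 * R) ^ 2 := by gcongr
      linarith
    calc _ ≤ 1 * (α ^ 2 * (5 / 4 * R) ^ 2 + α) := by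
          gcongr; exact mul_le_one₀ p1 n0 n1
      _ = _ := one_mul _
  have B : |α * tau1 R r * (muf R r * PsiInt α R r) - mu1 R r * PsiInt α R r - muf R r * psi α R r|
      ≤ 5 * α * R ^ 2 + 4 := by
    have b1 : α * tau1 R r * (muf R r * PsiInt α R r) ≤ α * (5 / 4 * R) * (1 * (4 * R)) := by
      gcongr
    have b10 : 0 ≤ α * tau1 R r * (muf R r * PsiInt α R r) := by positivity
    have b2 : |mu1 R r * PsiInt α R r| ≤ 2 / (3 * R) * (4 * R) := by
      rw [abs_mul, abs_of_nonneg P0]; gcongr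
    have e : 2 / (3 * R) * (4 * R) = 8 / 3 := by field_simp; norm_num
    rw [e, abs_le] at b2
    have b3 : muf R r * psi α R r ≤ 1 := mul_le_one₀ m1 p0 p1
    have b30 : 0 ≤ muf R r * psi α R r := by positivity
    rw [abs_le]
    constructor <;> nlinarith
  have D : |(α * tau1 R r * (muf R r * PsiInt α R r) - mu1 R r * PsiInt α R r
      - muf R r * psi α R r) / (2 * CC α R)| ≤ (5 * α * R ^ 2 + 4) / (2 * R ^ 2) := by
    rw [abs_div, abs_of_pos (by positivity : 0 < 2 * CC α R)]
    gcongr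
  have E := abs_add_le (psi α R r * nuf α R r * (α ^ 2 * tau1 R r ^ 2 - α * tau2 R r))
    ((α * tau1 R r * (muf R r * PsiInt α R r) - mu1 R r * PsiInt α R r
      - muf R r * psi α R r) / (2 * CC α R))
  have F1 : (5 * α * R ^ 2 + 4) / (2 * R ^ 2) = 5 / 2 * α + 2 / R ^ 2 := by field_simp; ring
  have F2 : 2 * (α * R ^ 2 + 1) / R ^ 2 = 2 * α + 2 / R ^ 2 := by field_simp
  rw [F2]
  rw [F1] at D
  have G : 0 ≤ α ^ 2 * R ^ 2 := by positivity
  unfold q3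
  nlinarith

theorem q_third_deriv_bounds (α R : ℝ) (hα : 0 < α) (hR : 0 < R) :
    ∀ r : ℝ, 0 ≤ r →
      DifferentiableAt ℝ (qf α R) r ∧
      DifferentiableAt ℝ (deriv (qf α R)) r ∧
      DifferentiableAt ℝ (deriv (deriv (qf α R))) r ∧
      |deriv (deriv (deriv (qf α R))) r| ≤
        5 * α + 2 * α * (α * R ^ 2 + 1) + 2 * (α * R ^ 2 + 1) / R ^ 2 := by
  have d1 : deriv (qf α R) = fun r => psi α R r * nuf α R r :=
    funext fun r => (q_deriv1 α R hR r).deriv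
  have d2 : deriv (fun r => psi α R r * nuf α R r) = fun r =>
      -(α * (tau1 R r * (psi α R r * nuf α R r))) - muf R r * PsiInt α R r / (2 * CC α R) :=
    funext fun r => (q_deriv2 α R hR r).deriv
  intro r hr
  refine ⟨(q_deriv1 α R hR r).differentiableAt, ?_, ?_, ?_⟩
  · rw [d1]; exact (q_deriv2 α R hR r).differentiableAt
  · rw [d1, d2]; exact (q_deriv3 α R hR r).differentiableAt
  · rw [d1, d2, (q_deriv3 α R hR r).deriv]; exact q3_bound α R hα hR r hr
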